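/- Properties of typing statements in a PTSC: if Γ ⊢ M : A then FV(M) ⊆ dom Γ, the statement Γ wf is derivable, and either A ∈ S or Γ ⊢ A : s is derivable for some sort s; if Γ; B ⊢ l : C then FV(l) ⊆ dom Γ, Γ wf is derivable, and Γ ⊢ B : s and Γ ⊢ C : s' are derivable for some sorts s, s'. -/

import Mathlib

set_option maxHeartbeats 1000000
set_option linter.unreachableTactic false
set_option linter.unusedTactic false

/- ### Syntax of PTSCα -/

mutual
inductive Trm (S : Type) : Type
  | pi    : ℕ → Trm S → Trm S → Trm S            -- Πx:A.B
  | lam   : ℕ → Trm S → Trm S → Trm S            -- λx:A.M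
  | sort  : S → Trm S
  | appv  : ℕ → Lst S → Trm S                     -- x l
  | app   : Trm S → Lst S → Trm S                 -- M l
  | esub  : Trm S → Trm S → ℕ → Trm S → Trm S    -- ⟨A, M/x⟩N
  | mvarT : ℕ → Args S → Trm S                    -- α(M₁,…,Mₙ)

inductive Lst (S : Type) : Type
  | nil   : Lst S
  | cons  : Trm S → Lst S → Lst S
  | conc  : Lst S → Lst S → Lst S
  | esub  : Trm S → Trm S → ℕ → Lst S → Lst S
  | mvarL : ℕ → Args S → Lst S

inductive Args (S : Type) : Type
  | nil   : Args S
  | cons  : Trm S → Args S → Args S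
end

/- Free variables -/
mutual
def fvT {S : Type} : Trm S → Finset ℕ
  | .pi x A B => fvT A ∪ (fvT B).erase x
  | .lam x A M => fvT A ∪ (fvT M).erase x
  | .sort _ => ∅
  | .appv x l => insert x (fvL l)
  | .app M l => fvT M ∪ fvL l
  | .esub A P x N => fvT A ∪ fvT P ∪ (fvT N).erase x
  | .mvarT _ args => fvA args
def fvL {S : Type} : Lst S → Finset ℕ
  | .nil => ∅
  | .cons M l => fvT M ∪ fvL l
  | .conc l l' => fvL l ∪ fvL l'
  | .esub A P x l => fvT A ∪ fvT P ∪ (fvL l).erase x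
  | .mvarL _ args => fvA args
def fvA {S : Type} : Args S → Finset ℕ
  | .nil => ∅
  | .cons M as => fvT M ∪ fvA as
end

/-- mapping an explicit substitution over the arguments of a meta-variable -/
def subArgs {S : Type} (A P : Trm S) (y : ℕ) : Args S → Args S
  | .nil => .nil
  | .cons M as => .cons (.esub A P y M) (subArgs A P y as)

/-- length of a sequence of meta-variable arguments -/
def argsLen {S : Type} : Args S → ℕ
  | .nil => 0
  | .cons _ as => argsLen as + 1

/- ### Reduction: root steps.
   `bB` tells whether rule B is included, `bX` whether system x' is included. -/

inductive TopT (S : Type) (bB bX : Bool) : Trm S → Trm S → Prop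
  | beta {x : ℕ} {A M N : Trm S} {l : Lst S} :
      bB = true → TopT S bB bX (.app (.lam x A M) (.cons N l)) (.app (.esub A N x M) l)
  | b1 {M : Trm S} : bX = true → TopT S bB bX (.app M .nil) M
  | b2 {x : ℕ} {l l' : Lst S} :
      bX = true → TopT S bB bX (.app (.appv x l) l') (.appv x (.conc l l'))
  | b3 {M : Trm S} {l l' : Lst S} :
      bX = true → TopT S bB bX (.app (.app M l) l') (.app M (.conc l l'))
  | c1 {G P A M : Trm S} {x y : ℕ} :
      bX = true → x ≠ y → x ∉ fvT P →
      TopT S bB bX (.esub G P y (.lam x A M)) (.lam x (.esub G P y A) (.esub G P y M))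
  | c2 {G P : Trm S} {y : ℕ} {l : Lst S} :
      bX = true → TopT S bB bX (.esub G P y (.appv y l)) (.app P (.esub G P y l))
  | c3 {G P : Trm S} {x y : ℕ} {l : Lst S} :
      bX = true → x ≠ y → TopT S bB bX (.esub G P y (.appv x l)) (.appv x (.esub G P y l))
  | c4 {G P M : Trm S} {y : ℕ} {l : Lst S} :
      bX = true → TopT S bB bX (.esub G P y (.app M l)) (.app (.esub G P y M) (.esub G P y l))
  | c5 {G P A B : Trm S} {x y : ℕ} :
      bX = true → x ≠ y → x ∉ fvT P →
      TopT S bB bX (.esub G P y (.pi x A B)) (.pi x (.esub G P y A) (.esub G P y B))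
  | c6 {G P : Trm S} {y : ℕ} {s : S} :
      bX = true → TopT S bB bX (.esub G P y (.sort s)) (.sort s)
  | calpha {A P : Trm S} {y a : ℕ} {args : Args S} :
      bX = true → TopT S bB bX (.esub A P y (.mvarT a args)) (.mvarT a (subArgs A P y args))

inductive TopL (S : Type) (bB bX : Bool) : Lst S → Lst S → Prop
  | a1 {M : Trm S} {l l' : Lst S} :
      bX = true → TopL S bB bX (.conc (.cons M l') l) (.cons M (.conc l' l))
  | a2 {l : Lst S} : bX = true → TopL S bB bX (.conc .nil l) l
  | a3 {l l' l'' : Lst S} :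
      bX = true → TopL S bB bX (.conc (.conc l l') l'') (.conc l (.conc l' l''))
  | a4 {l : Lst S} : bX = true → TopL S bB bX (.conc l .nil) l
  | d1 {G P : Trm S} {y : ℕ} : bX = true → TopL S bB bX (.esub G P y .nil) .nil
  | d2 {G P M : Trm S} {y : ℕ} {l : Lst S} :
      bX = true → TopL S bB bX (.esub G P y (.cons M l)) (.cons (.esub G P y M) (.esub G P y l))
  | d3 {G P : Trm S} {y : ℕ} {l l' : Lst S} :
      bX = true → TopL S bB bX (.esub G P y (.conc l l')) (.conc (.esub G P y l) (.esub G P y l'))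
  | dbeta {A P : Trm S} {y b : ℕ} {args : Args S} :
      bX = true → TopL S bB bX (.esub A P y (.mvarL b args)) (.mvarL b (subArgs A P y args))

/- ### Contextual closure -/

mutual
inductive RedT (S : Type) (bB bX : Bool) : Trm S → Trm S → Prop
  | top {M N : Trm S} : TopT S bB bX M N → RedT S bB bX M N
  | pi1 {x : ℕ} {A A' B : Trm S} : RedT S bB bX A A' → RedT S bB bX (.pi x A B) (.pi x A' B)
  | pi2 {x : ℕ} {A B B' : Trm S} : RedT S bB bX B B' → RedT S bB bX (.pi x A B) (.pi x A B')
  | lam1 {x : ℕ} {A A' M : Trm S} : RedT S bB bX A A' → RedT S bB bX (.lam x A M) (.lam x A' M)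
  | lam2 {x : ℕ} {A M M' : Trm S} : RedT S bB bX M M' → RedT S bB bX (.lam x A M) (.lam x A M')
  | appv1 {x : ℕ} {l l' : Lst S} : RedL S bB bX l l' → RedT S bB bX (.appv x l) (.appv x l')
  | app1 {M M' : Trm S} {l : Lst S} : RedT S bB bX M M' → RedT S bB bX (.app M l) (.app M' l)
  | app2 {M : Trm S} {l l' : Lst S} : RedL S bB bX l l' → RedT S bB bX (.app M l) (.app M l')
  | esub1 {A A' P N : Trm S} {x : ℕ} :
      RedT S bB bX A A' → RedT S bB bX (.esub A P x N) (.esub A' P x N)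
  | esub2 {A P P' N : Trm S} {x : ℕ} :
      RedT S bB bX P P' → RedT S bB bX (.esub A P x N) (.esub A P' x N)
  | esub3 {A P N N' : Trm S} {x : ℕ} :
      RedT S bB bX N N' → RedT S bB bX (.esub A P x N) (.esub A P x N')
  | mvar1 {a : ℕ} {args args' : Args S} :
      RedA S bB bX args args' → RedT S bB bX (.mvarT a args) (.mvarT a args')

inductive RedL (S : Type) (bB bX : Bool) : Lst S → Lst S → Prop
  | top {l l' : Lst S} : TopL S bB bX l l' → RedL S bB bX l l'
  | cons1 {M M' : Trm S} {l : Lst S} : RedT S bB bX M M' → RedL S bB bX (.cons M l) (.cons M' l)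
  | cons2 {M : Trm S} {l l' : Lst S} : RedL S bB bX l l' → RedL S bB bX (.cons M l) (.cons M l')
  | conc1 {l l' m : Lst S} : RedL S bB bX l l' → RedL S bB bX (.conc l m) (.conc l' m)
  | conc2 {l m m' : Lst S} : RedL S bB bX m m' → RedL S bB bX (.conc l m) (.conc l m')
  | esub1 {A A' P : Trm S} {x : ℕ} {l : Lst S} :
      RedT S bB bX A A' → RedL S bB bX (.esub A P x l) (.esub A' P x l)
  | esub2 {A P P' : Trm S} {x : ℕ} {l : Lst S} :
      RedT S bB bX P P' → RedL S bB bX (.esub A P x l) (.esub A P' x l)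
  | esub3 {A P : Trm S} {x : ℕ} {l l' : Lst S} :
      RedL S bB bX l l' → RedL S bB bX (.esub A P x l) (.esub A P x l')
  | mvar1 {b : ℕ} {args args' : Args S} :
      RedA S bB bX args args' → RedL S bB bX (.mvarL b args) (.mvarL b args')

inductive RedA (S : Type) (bB bX : Bool) : Args S → Args S → Prop
  | hd {M M' : Trm S} {as : Args S} : RedT S bB bX M M' → RedA S bB bX (.cons M as) (.cons M' as)
  | tl {M : Trm S} {as as' : Args S} : RedA S bB bX as as' → RedA S bB bX (.cons M as) (.cons M as')
end

/-- one-step reduction by system x' alone, on terms -/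
abbrev RedXT (S : Type) : Trm S → Trm S → Prop := RedT S false true
/-- one-step reduction by system x' alone, on lists -/
abbrev RedXL (S : Type) : Lst S → Lst S → Prop := RedL S false true
/-- one-step reduction by rule B alone, on terms -/
abbrev RedBT (S : Type) : Trm S → Trm S → Prop := RedT S true false
/-- one-step reduction by rule B alone, on lists -/
abbrev RedBL (S : Type) : Lst S → Lst S → Prop := RedL S true false
/-- one-step reduction by B together with x', on terms -/
abbrev RedBXT (S : Type) : Trm S → Trm S → Prop := RedT S true true
/-- one-step reduction by B together with x', on lists -/
abbrev RedBXL (S : Type) : Lst S → Lst S → Prop := RedL S true true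

/- ### Typing for PTSC (the ground fragment of PTSCα) -/

/-- conversion generated by B together with x', on terms -/
abbrev ConvT (S : Type) : Trm S → Trm S → Prop := Relation.EqvGen (RedBXT S)

/-- reflexive-transitive closure of B together with x', on terms -/
abbrev RedsBXT (S : Type) : Trm S → Trm S → Prop := Relation.ReflTransGen (RedBXT S)

/-- typing environments -/
abbrev Env (S : Type) := List (ℕ × Trm S)

/-- the domain of an environment (the most recently introduced variable comes first) -/
def dom {S : Type} (Γ : Env S) : List ℕ := Γ.map Prod.fst

/-- application of an explicit substitution to an environment -/
def subEnv {S : Type} (A P : Trm S) (x : ℕ) (Δ : Env S) : Env S :=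
  Δ.map (fun p => (p.1, Trm.esub A P x p.2))

/-- the inclusion relation Γ ⊑ Δ between environments -/
def EnvLe {S : Type} (Γ Δ : Env S) : Prop :=
  ∀ x A, (x, A) ∈ Γ → ∃ B, (x, B) ∈ Δ ∧ ConvT S A B

mutual
/-- the judgment `Γ wf` of a PTSC with axioms `Ax` and rules `Rl` -/
inductive Wf (S : Type) (Ax : Set (S × S)) (Rl : Set (S × S × S)) : Env S → Prop
  | empty : Wf S Ax Rl []
  | extend {Γ : Env S} {A : Trm S} {s : S} {x : ℕ} :
      Ty S Ax Rl Γ A (.sort s) → x ∉ dom Γ → Wf S Ax Rl ((x, A) :: Γ)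

/-- the term-typing judgment `Γ ⊢ M : A` of a PTSC -/
inductive Ty (S : Type) (Ax : Set (S × S)) (Rl : Set (S × S × S)) :
    Env S → Trm S → Trm S → Prop
  | sorted {Γ : Env S} {s s' : S} :
      Wf S Ax Rl Γ → (s, s') ∈ Ax → Ty S Ax Rl Γ (.sort s) (.sort s')
  | piwf {Γ : Env S} {A B : Trm S} {x : ℕ} {s₁ s₂ s₃ : S} :
      Ty S Ax Rl Γ A (.sort s₁) → Ty S Ax Rl ((x, A) :: Γ) B (.sort s₂) →
      (s₁, s₂, s₃) ∈ Rl → Ty S Ax Rl Γ (.pi x A B) (.sort s₃)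
  | piR {Γ : Env S} {A B M : Trm S} {x : ℕ} {s : S} :
      Ty S Ax Rl Γ (.pi x A B) (.sort s) → Ty S Ax Rl ((x, A) :: Γ) M B →
      Ty S Ax Rl Γ (.lam x A M) (.pi x A B)
  | contr {Γ : Env S} {A B : Trm S} {l : Lst S} {x : ℕ} :
      TyL S Ax Rl Γ A l B → (x, A) ∈ Γ → Ty S Ax Rl Γ (.appv x l) B
  | convR {Γ : Env S} {M A B : Trm S} {s : S} :
      Ty S Ax Rl Γ M A → Ty S Ax Rl Γ B (.sort s) → ConvT S A B → Ty S Ax Rl Γ M B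
  | cut3 {Γ : Env S} {M A B : Trm S} {l : Lst S} :
      Ty S Ax Rl Γ M A → TyL S Ax Rl Γ A l B → Ty S Ax Rl Γ (.app M l) B
  | cut4 {Γ Δ Δ' : Env S} {P A M C C' : Trm S} {x : ℕ} :
      Ty S Ax Rl Γ P A → Ty S Ax Rl (Δ ++ (x, A) :: Γ) M C →
      EnvLe (subEnv A P x Δ ++ Γ) Δ' → Wf S Ax Rl Δ' →
      ((∃ s : S, C = .sort s) ∧ C' = C ∨ (¬ ∃ s : S, C = .sort s) ∧ C' = .esub A P x C) →
      Ty S Ax Rl Δ' (.esub A P x M) C'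

/-- the list-typing judgment `Γ; B ⊢ l : C` of a PTSC (with B in the stoup) -/
inductive TyL (S : Type) (Ax : Set (S × S)) (Rl : Set (S × S × S)) :
    Env S → Trm S → Lst S → Trm S → Prop
  | ax {Γ : Env S} {A : Trm S} {s : S} :
      Ty S Ax Rl Γ A (.sort s) → TyL S Ax Rl Γ A .nil A
  | piL {Γ : Env S} {A B M C : Trm S} {l : Lst S} {x : ℕ} {s : S} :
      Ty S Ax Rl Γ (.pi x A B) (.sort s) → Ty S Ax Rl Γ M A →
      TyL S Ax Rl Γ (.esub A M x B) l C → TyL S Ax Rl Γ (.pi x A B) (.cons M l) C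
  | convR' {Γ : Env S} {C A B : Trm S} {l : Lst S} {s : S} :
      TyL S Ax Rl Γ C l A → Ty S Ax Rl Γ B (.sort s) → ConvT S A B → TyL S Ax Rl Γ C l B
  | convL {Γ : Env S} {A B C : Trm S} {l : Lst S} {s : S} :
      TyL S Ax Rl Γ A l C → Ty S Ax Rl Γ B (.sort s) → ConvT S A B → TyL S Ax Rl Γ B l C
  | cut1 {Γ : Env S} {A B C : Trm S} {l l' : Lst S} :
      TyL S Ax Rl Γ C l' A → TyL S Ax Rl Γ A l B → TyL S Ax Rl Γ C (.conc l' l) B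
  | cut2 {Γ Δ Δ' : Env S} {P A B C : Trm S} {l : Lst S} {x : ℕ} :
      Ty S Ax Rl Γ P A → TyL S Ax Rl (Δ ++ (x, A) :: Γ) B l C →
      EnvLe (subEnv A P x Δ ++ Γ) Δ' → Wf S Ax Rl Δ' →
      TyL S Ax Rl Δ' (.esub A P x B) (.esub A P x l) (.esub A P x C)
end

theorem EnvLe.dom_subset {S : Type} {Γ Δ : Env S} (h : EnvLe Γ Δ) : dom Γ ⊆ dom Δ := by
  intro x hx
  obtain ⟨⟨y, A⟩, hA, rfl⟩ := List.mem_map.1 hx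
  obtain ⟨B, hB, -⟩ := h y A hA
  exact List.mem_map.2 ⟨_, hB, rfl⟩

theorem dom_cons {S : Type} (x : ℕ) (A : Trm S) (Γ : Env S) :
    dom ((x, A) :: Γ) = x :: dom Γ := rfl

theorem dom_append {S : Type} (Γ Δ : Env S) : dom (Γ ++ Δ) = dom Γ ++ dom Δ :=
  List.map_append

theorem dom_subEnv {S : Type} (A P : Trm S) (x : ℕ) (Δ : Env S) :
    dom (subEnv A P x Δ) = dom Δ := by
  simp [dom, subEnv]

/-- Variables of the environments on the left of a cut, other than the one substituted,
occur in any environment extending the substituted one. -/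
theorem EnvLe.mem_dom_of_cut {S : Type} {Γ Δ Δ' : Env S} {A P : Trm S} {x : ℕ}
    (h : EnvLe (subEnv A P x Δ ++ Γ) Δ') :
    (∀ y ∈ dom Γ, y ∈ dom Δ') ∧
      ∀ y ∈ dom (Δ ++ (x, A) :: Γ), y ≠ x → y ∈ dom Δ' := by
  have hs := h.dom_subset
  rw [dom_append, dom_subEnv] at hs
  refine ⟨fun y hy => hs (List.mem_append_right _ hy), fun y hy hyx => hs ?_⟩
  simpa [dom_append, dom_cons, hyx] using hy

section Typing

variable {S : Type} {Ax : Set (S × S)} {Rl : Set (S × S × S)}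

theorem Ty.fv_mem_dom {Γ : Env S} {M A : Trm S} (h : Ty S Ax Rl Γ M A) :
    (∀ x ∈ fvT M, x ∈ dom Γ) ∧ ∀ x ∈ fvT A, x ∈ dom Γ := by
  induction h using Ty.rec (motive_1 := fun _ _ => True)
    (motive_3 := fun Γ B l C _ => (∀ x ∈ fvL l, x ∈ dom Γ) ∧
      (∀ x ∈ fvT B, x ∈ dom Γ) ∧ ∀ x ∈ fvT C, x ∈ dom Γ) with
  | empty | extend => trivial
  | contr _ hx ih =>
    have hx' := List.mem_map_of_mem (f := Prod.fst) hx
    simp only [fvT, Finset.mem_insert]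
    exact ⟨fun y hy => hy.elim (fun h => h ▸ hx') (ih.1 y), ih.2.2⟩
  | cut4 _ _ hle _ hC ihP ihM _ =>
    obtain ⟨hΓ, hΔ⟩ := hle.mem_dom_of_cut
    rcases hC with ⟨⟨s, rfl⟩, rfl⟩ | ⟨-, rfl⟩ <;>
      simp only [fvT, Finset.mem_union, Finset.mem_erase, Finset.notMem_empty] at * <;>
      grind
  | cut2 _ _ hle _ ihP ihl _ =>
    obtain ⟨hΓ, hΔ⟩ := hle.mem_dom_of_cut
    simp only [fvT, fvL, Finset.mem_union, Finset.mem_erase]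
    grind
  | _ =>
    simp only [dom_cons, fvT, fvL, List.mem_cons, Finset.mem_union, Finset.mem_erase,
      Finset.notMem_empty] at *
    grind

theorem TyL.fv_mem_dom {Γ : Env S} {B C : Trm S} {l : Lst S} (h : TyL S Ax Rl Γ B l C) :
    ∀ x ∈ fvL l, x ∈ dom Γ := by
  induction h using TyL.rec (motive_1 := fun _ _ => True) (motive_2 := fun _ _ _ _ => True) with
  | ax => simp [fvL]
  | piL _ hM _ _ _ ihl =>
    have := hM.fv_mem_dom
    simp only [fvL, Finset.mem_union]
    grind
  | convR' _ _ _ ih | convL _ _ _ ih => exact ih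
  | cut1 _ _ ihl' ihl =>
    simp only [fvL, Finset.mem_union]
    grind
  | cut2 hP _ hle _ _ ihl _ =>
    have := hP.fv_mem_dom
    obtain ⟨hΓ, hΔ⟩ := hle.mem_dom_of_cut
    simp only [fvL, Finset.mem_union, Finset.mem_erase]
    grind
  | _ => trivial

theorem Ty.wf {Γ : Env S} {M A : Trm S} (h : Ty S Ax Rl Γ M A) : Wf S Ax Rl Γ := by
  induction h using Ty.rec (motive_1 := fun _ _ => True)
    (motive_3 := fun Γ _ _ _ _ => Wf S Ax Rl Γ) with
  | empty | extend => trivial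
  | _ => assumption

/-- A substitution instance of a type having a sort has the same sort. -/
theorem Ty.esub_sort {Γ Δ Δ' : Env S} {P A C : Trm S} {x : ℕ} {s : S}
    (hP : Ty S Ax Rl Γ P A) (hC : Ty S Ax Rl (Δ ++ (x, A) :: Γ) C (.sort s))
    (hle : EnvLe (subEnv A P x Δ ++ Γ) Δ') (hΔ : Wf S Ax Rl Δ') :
    Ty S Ax Rl Δ' (.esub A P x C) (.sort s) :=
  .cut4 hP hC hle hΔ (.inl ⟨⟨s, rfl⟩, rfl⟩)

theorem TyL.exists_sort {Γ : Env S} {B C : Trm S} {l : Lst S} (h : TyL S Ax Rl Γ B l C) :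
    (∃ s : S, Ty S Ax Rl Γ B (.sort s)) ∧ ∃ s' : S, Ty S Ax Rl Γ C (.sort s') := by
  induction h using TyL.rec (motive_1 := fun _ _ => True) (motive_2 := fun _ _ _ _ => True) with
  | ax hA => exact ⟨⟨_, hA⟩, ⟨_, hA⟩⟩
  | piL hP _ _ _ _ ih => exact ⟨⟨_, hP⟩, ih.2⟩
  | convR' _ hB _ ih => exact ⟨ih.1, ⟨_, hB⟩⟩
  | convL _ hB _ ih => exact ⟨⟨_, hB⟩, ih.2⟩
  | cut1 _ _ ihl' ihl => exact ⟨ihl'.1, ihl.2⟩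
  | cut2 hP _ hle hΔ _ ih =>
    obtain ⟨⟨s, hB⟩, s', hC⟩ := ih
    exact ⟨⟨s, hP.esub_sort hB hle hΔ⟩, ⟨s', hP.esub_sort hC hle hΔ⟩⟩
  | _ => trivial

theorem TyL.wf {Γ : Env S} {B C : Trm S} {l : Lst S} (h : TyL S Ax Rl Γ B l C) :
    Wf S Ax Rl Γ :=
  let ⟨_, hB⟩ := h.exists_sort.1
  hB.wf

theorem Ty.sort_or_exists_sort {Γ : Env S} {M A : Trm S} (h : Ty S Ax Rl Γ M A) :
    (∃ s : S, A = .sort s) ∨ ∃ s : S, Ty S Ax Rl Γ A (.sort s) := by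
  induction h using Ty.rec (motive_1 := fun _ _ => True)
    (motive_3 := fun _ _ _ _ _ => True) with
  | sorted | piwf => exact .inl ⟨_, rfl⟩
  | piR hP => exact .inr ⟨_, hP⟩
  | contr hl => exact .inr hl.exists_sort.2
  | convR _ hB => exact .inr ⟨_, hB⟩
  | cut3 _ hl => exact .inr hl.exists_sort.2
  | cut4 hP _ hle hΔ hC _ ihM =>
    rcases hC with ⟨⟨s, rfl⟩, rfl⟩ | ⟨hns, rfl⟩
    · exact .inl ⟨s, rfl⟩
    · obtain ⟨s, hs⟩ := ihM.resolve_left hns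
      exact .inr ⟨s, hP.esub_sort hs hle hΔ⟩
  | _ => trivial

end Typing

/-- Properties of typing statements in a PTSC: if `Γ ⊢ M : A` then
`FV(M) ⊆ dom Γ`, the statement `Γ wf` is derivable, and either `A ∈ S` or `Γ ⊢ A : s`
is derivable for some sort `s`; if `Γ; B ⊢ l : C` then `FV(l) ⊆ dom Γ`, `Γ wf` is
derivable, and `Γ ⊢ B : s` and `Γ ⊢ C : s'` are derivable for some sorts `s`, `s'`. -/
theorem typing_statement_properties (S : Type) (Ax : Set (S × S)) (Rl : Set (S × S × S)) :
    (∀ (Γ : Env S) (M A : Trm S), Ty S Ax Rl Γ M A →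
        (∀ x ∈ fvT M, x ∈ dom Γ) ∧ Wf S Ax Rl Γ ∧
        ((∃ s : S, A = .sort s) ∨ ∃ s : S, Ty S Ax Rl Γ A (.sort s))) ∧
    (∀ (Γ : Env S) (B C : Trm S) (l : Lst S), TyL S Ax Rl Γ B l C →
        (∀ x ∈ fvL l, x ∈ dom Γ) ∧ Wf S Ax Rl Γ ∧
        (∃ s : S, Ty S Ax Rl Γ B (.sort s)) ∧ (∃ s' : S, Ty S Ax Rl Γ C (.sort s'))) :=
  ⟨fun _ _ _ h => ⟨h.fv_mem_dom.1, h.wf, h.sort_or_exists_sort⟩,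
    fun _ _ _ _ h => ⟨h.fv_mem_dom, h.wf, h.exists_sort⟩⟩
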